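/- Under the stated setting, suppose that zer(A + S) ≠ ∅, that u_n − x_n → 0 strongly, that e_n* → 0 strongly, that (f_n*)_{n∈ℕ} is bounded, and that there exists δ ∈ (0,1) such that for every n ∈ ℕ: ⟨u_n − y_n, f_n*⟩ ≥ −δ⟨u_n − y_n, F_n u_n − F_n y_n⟩ and ⟨a_n* + S u_n − e_n*, f_n*⟩ ≤ δ‖a_n* + S u_n − e_n*‖². Then f_n* → 0 strongly. -/

import Mathlib

open Filter Topology RealInnerProductSpace

/-- A set-valued operator `A : H → 2^H` is monotone. -/
def IsMonotoneOp {H : Type*} [NormedAddCommGroup H] [InnerProductSpace ℝ H]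
    (A : H → Set H) : Prop :=
  ∀ x y u v, u ∈ A x → v ∈ A y → 0 ≤ ⟪x - y, u - v⟫

/-- A set-valued operator is maximally monotone if it is monotone and its graph is not
properly contained in the graph of another monotone operator. -/
def IsMaximalMonotone {H : Type*} [NormedAddCommGroup H] [InnerProductSpace ℝ H]
    (A : H → Set H) : Prop :=
  IsMonotoneOp A ∧
    ∀ A' : H → Set H, IsMonotoneOp A' → (∀ x, A x ⊆ A' x) → ∀ x, A' x ⊆ A x

/-- `f_n* → 0` strongly. -/
theorem theorem1_f_to_zero
    {H : Type*} [NormedAddCommGroup H] [InnerProductSpace ℝ H] [CompleteSpace H]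
    (A : H → Set H) (hA : IsMaximalMonotone A)
    (S : H →L[ℝ] H) (hS : ContinuousLinearMap.adjoint S = -S)
    (ε α ρ : ℝ) (hε : ε ∈ Set.Ioo (0 : ℝ) 1) (hα : 0 < α) (hαρ : α ≤ ρ)
    (F : ℕ → H → H)
    (hFstrong : ∀ n x y, α * ‖x - y‖ ^ 2 ≤ ⟪x - y, F n x - F n y⟫)
    (hFlip : ∀ n x y, ‖F n x - F n y‖ ≤ ρ * ‖x - y‖)
    (lam : ℕ → ℝ) (hlam : ∀ n, lam n ∈ Set.Icc ε (2 - ε))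
    (x u estar fstar ustar y astar ystar : ℕ → H) (π : ℕ → ℝ)
    (hustar : ∀ n, ustar n = F n (u n) - S (u n) + estar n + fstar n)
    (hy : ∀ n, ustar n - F n (y n) ∈ A (y n))
    (hastar : ∀ n, astar n = ustar n - F n (y n))
    (hystar : ∀ n, ystar n = astar n + S (y n))
    (hπ : ∀ n, π n = ⟪x n, ystar n⟫ - ⟪y n, astar n⟫)
    (hupd_pos : ∀ n, 0 < π n →
      x (n + 1) = x n - ((lam n * π n) / ‖ystar n‖ ^ 2) • ystar n)
    (hupd_neg : ∀ n, ¬ 0 < π n → x (n + 1) = x n)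
    (hzer : ∃ z, -(S z) ∈ A z)
    (hux : Filter.Tendsto (fun n => u n - x n) Filter.atTop (nhds 0))
    (he : Filter.Tendsto estar Filter.atTop (nhds 0))
    (hf : Bornology.IsBounded (Set.range fstar))
    (hδ : ∃ δ ∈ Set.Ioo (0 : ℝ) 1, ∀ n,
      -(δ * ⟪u n - y n, F n (u n) - F n (y n)⟫) ≤ ⟪u n - y n, fstar n⟫ ∧
      ⟪astar n + S (u n) - estar n, fstar n⟫ ≤ δ * ‖astar n + S (u n) - estar n‖ ^ 2) :
    Filter.Tendsto fstar Filter.atTop (nhds 0) := by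
  obtain ⟨hmono, -⟩ := hA
  obtain ⟨z, hz⟩ := hzer
  obtain ⟨δ, ⟨hδ0, hδ1⟩, hδ⟩ := hδ
  obtain ⟨hε0, hε1⟩ := hε
  have hρ : 0 < ρ := lt_of_lt_of_le hα hαρ
  have hSS : ∀ a b : H, ⟪a, S b⟫ = -⟪S a, b⟫ := by
    intro a b
    rw [← ContinuousLinearMap.adjoint_inner_left, hS]
    simp
  have hS0 : ∀ a : H, ⟪a, S a⟫ = 0 := by
    intro a
    have h1 := hSS a a
    rw [real_inner_comm a (S a)] at h1
    have h2 := real_inner_comm a (S a)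
    linarith
  have hmz : ∀ n, 0 ≤ ⟪y n - z, astar n + S z⟫ := by
    intro n
    have := hmono (y n) z _ _ (hy n) hz
    rwa [← hastar, sub_neg_eq_add] at this
  have hπz : ∀ n, π n ≤ ⟪x n - z, ystar n⟫ := by
    intro n
    have h1 := hmz n
    have h2 := hSS z (y n)
    have h3 := hS0 z
    have h4 := real_inner_comm (S z) (y n)
    have h5 := real_inner_comm (S z) z
    rw [hπ, hystar]
    simp only [inner_add_right, inner_sub_left] at h1 ⊢
    linarith
  have hπ' : ∀ n, π n = ⟪x n - y n, ystar n⟫ := by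
    intro n
    have h3 := hS0 (y n)
    rw [hπ, hystar]
    simp only [inner_add_right, inner_sub_left]
    linarith
  have hya : ∀ n, ystar n = (F n (u n) - F n (y n)) - S (u n - y n) + estar n + fstar n := by
    intro n
    rw [hystar, hastar, hustar, map_sub]
    abel
  -- Fejer monotonicity
  have hfej : ∀ n, ‖x (n + 1) - z‖ ^ 2 ≤ ‖x n - z‖ ^ 2 ∧
      ε ^ 2 * (max (π n) 0) ^ 2 ≤
        ‖ystar n‖ ^ 2 * (‖x n - z‖ ^ 2 - ‖x (n + 1) - z‖ ^ 2) := by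
    intro n
    by_cases hp : 0 < π n
    · have hN : 0 < ‖ystar n‖ ^ 2 := by
        have : ystar n ≠ 0 := by
          intro h
          have := hπ' n
          rw [h, inner_zero_right] at this
          linarith
        positivity
      have hx := hupd_pos n hp
      set c := lam n * π n / ‖ystar n‖ ^ 2 with hc
      have hcN : c * ‖ystar n‖ ^ 2 = lam n * π n := by
        rw [hc]; exact div_mul_cancel₀ _ hN.ne'
      have hexp : ‖x (n + 1) - z‖ ^ 2 =
          ‖x n - z‖ ^ 2 - 2 * (c * ⟪x n - z, ystar n⟫) + c ^ 2 * ‖ystar n‖ ^ 2 := by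
        rw [hx, sub_right_comm, norm_sub_sq_real, inner_smul_right, norm_smul, mul_pow,
          Real.norm_eq_abs, sq_abs]
      obtain ⟨hl1, hl2⟩ := hlam n
      have hlp : 0 < lam n * π n := mul_pos (by linarith) hp
      have hkey : ε ^ 2 * (π n) ^ 2 ≤
          ‖ystar n‖ ^ 2 * (‖x n - z‖ ^ 2 - ‖x (n + 1) - z‖ ^ 2) := by
        have e1 : ‖ystar n‖ ^ 2 * (‖x n - z‖ ^ 2 - ‖x (n + 1) - z‖ ^ 2) =
            2 * (lam n * π n) * ⟪x n - z, ystar n⟫ - (lam n * π n) ^ 2 := by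
          rw [hexp, ← hcN]; ring
        rw [e1]
        have e2 := mul_le_mul_of_nonneg_left (hπz n) hlp.le
        have e3 : ε * ε ≤ lam n * (2 - lam n) :=
          mul_le_mul hl1 (by linarith) hε0.le (by linarith)
        have e4 := mul_le_mul_of_nonneg_right e3 (sq_nonneg (π n))
        nlinarith
      refine ⟨?_, by rwa [max_eq_left hp.le]⟩
      have h0 : 0 ≤ ‖ystar n‖ ^ 2 * (‖x n - z‖ ^ 2 - ‖x (n + 1) - z‖ ^ 2) :=
        le_trans (by positivity) hkey
      have := nonneg_of_mul_nonneg_right h0 hN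
      linarith
    · rw [hupd_neg n hp, max_eq_right (not_lt.mp hp)]
      simp
  have hanti : Antitone (fun n => ‖x n - z‖ ^ 2) := antitone_nat_of_succ_le fun n => (hfej n).1
  have hdiff : Tendsto (fun n => ‖x n - z‖ ^ 2 - ‖x (n + 1) - z‖ ^ 2) atTop (𝓝 0) := by
    have hb : BddBelow (Set.range (fun n => ‖x n - z‖ ^ 2)) :=
      ⟨0, by rintro _ ⟨n, rfl⟩; positivity⟩
    have h1 := tendsto_atTop_ciInf hanti hb
    have h2 := h1.sub ((tendsto_add_atTop_iff_nat 1).2 h1)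
    simpa using h2
  -- boundedness
  obtain ⟨Cf, hCf⟩ : ∃ C, ∀ n, ‖fstar n‖ ≤ C := by
    obtain ⟨C, hC⟩ := hf.exists_norm_le
    exact ⟨C, fun n => hC _ ⟨n, rfl⟩⟩
  obtain ⟨Ce, hCe⟩ : ∃ C, ∀ n, ‖estar n‖ ≤ C := by
    obtain ⟨C, hC⟩ := (Metric.isBounded_range_of_tendsto _ he).exists_norm_le
    exact ⟨C, fun n => hC _ ⟨n, rfl⟩⟩
  obtain ⟨Cu, hCu⟩ : ∃ C, ∀ n, ‖u n - x n‖ ≤ C := by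
    obtain ⟨C, hC⟩ := (Metric.isBounded_range_of_tendsto _ hux).exists_norm_le
    exact ⟨C, fun n => hC _ ⟨n, rfl⟩⟩
  have hxz : ∀ n, ‖x n - z‖ ≤ ‖x 0 - z‖ := fun n =>
    (sq_le_sq₀ (norm_nonneg _) (norm_nonneg _)).1 (hanti (Nat.zero_le n))
  obtain ⟨U, hU⟩ : ∃ C, ∀ n, ‖u n - z‖ ≤ C := by
    refine ⟨Cu + ‖x 0 - z‖, fun n => ?_⟩
    have := norm_add_le (u n - x n) (x n - z)
    rw [sub_add_sub_cancel] at this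
    linarith [hCu n, hxz n]
  have hSb : ∀ a, ‖S a‖ ≤ ‖S‖ * ‖a‖ := S.le_opNorm
  have hbd : ∀ n (a b : H), ‖(F n a - F n b) - S (a - b) + estar n + fstar n‖ ≤
      (ρ + ‖S‖) * ‖a - b‖ + Ce + Cf := by
    intro n a b
    have h1 := norm_add_le ((F n a - F n b) - S (a - b) + estar n) (fstar n)
    have h2 := norm_add_le ((F n a - F n b) - S (a - b)) (estar n)
    have h3 := norm_sub_le (F n a - F n b) (S (a - b))
    linarith [hFlip n a b, hSb (a - b), hCe n, hCf n]
  have hyz : ∀ n, α * ‖y n - z‖ ≤ (ρ + ‖S‖) * U + Ce + Cf := by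
    intro n
    have h1 := hFstrong n (y n) z
    have h2 := hmz n
    have h3 : α * ‖y n - z‖ ^ 2 ≤
        ⟪y n - z, (F n (u n) - F n z) - S (u n - z) + estar n + fstar n⟫ := by
      have e : (F n (u n) - F n z) - S (u n - z) + estar n + fstar n =
          (F n (y n) - F n z) + (astar n + S z) := by
        rw [hastar, hustar, map_sub]; abel
      rw [e, inner_add_right]
      linarith
    have h4 := h3.trans (real_inner_le_norm _ _)
    have h5 := hbd n (u n) z
    have h6 : (ρ + ‖S‖) * ‖u n - z‖ ≤ (ρ + ‖S‖) * U :=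
      mul_le_mul_of_nonneg_left (hU n) (by positivity)
    rcases (norm_nonneg (y n - z)).eq_or_lt with h0 | h0
    · rw [← h0, mul_zero]
      linarith [norm_nonneg ((F n (u n) - F n z) - S (u n - z) + estar n + fstar n)]
    · have h7 : ‖y n - z‖ * (α * ‖y n - z‖) ≤ ‖y n - z‖ *
          ‖(F n (u n) - F n z) - S (u n - z) + estar n + fstar n‖ := by
        linarith [h4, sq (‖y n - z‖)]
      have h8 := le_of_mul_le_mul_left h7 h0
      linarith
  obtain ⟨V, hV⟩ : ∃ C, ∀ n, ‖u n - y n‖ ≤ C := by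
    refine ⟨U + ((ρ + ‖S‖) * U + Ce + Cf) / α, fun n => ?_⟩
    have h1 := norm_sub_le (u n - z) (y n - z)
    rw [sub_sub_sub_cancel_right] at h1
    have h2 : ‖y n - z‖ ≤ ((ρ + ‖S‖) * U + Ce + Cf) / α := by
      rw [le_div_iff₀ hα, mul_comm]; exact hyz n
    linarith [hU n]
  obtain ⟨Y, hY⟩ : ∃ C, ∀ n, ‖ystar n‖ ≤ C := by
    refine ⟨(ρ + ‖S‖) * V + Ce + Cf, fun n => ?_⟩
    have h5 := hbd n (u n) (y n)
    rw [← hya] at h5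
    have h6 : (ρ + ‖S‖) * ‖u n - y n‖ ≤ (ρ + ‖S‖) * V :=
      mul_le_mul_of_nonneg_left (hV n) (by positivity)
    linarith
  -- the positive part of `π` tends to zero
  have hsqrt : ∀ g : ℕ → ℝ, (∀ n, 0 ≤ g n) → Tendsto (fun n => g n ^ 2) atTop (𝓝 0) →
      Tendsto g atTop (𝓝 0) := by
    intro g hg h
    have := h.sqrt
    simpa [Real.sqrt_sq (hg _)] using this
  have hπ0 : Tendsto (fun n => max (π n) 0) atTop (𝓝 0) := by
    apply hsqrt _ (fun n => le_max_right _ _)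
    have h1 := hdiff.const_mul (Y ^ 2 / ε ^ 2)
    rw [mul_zero] at h1
    refine squeeze_zero (fun n => by positivity) (fun n => ?_) h1
    have h2 := (hfej n).2
    have h3 : ‖ystar n‖ ^ 2 ≤ Y ^ 2 := pow_le_pow_left₀ (norm_nonneg _) (hY n) 2
    have h4 := mul_le_mul_of_nonneg_right h3 (sub_nonneg.2 (hfej n).1)
    rw [div_mul_eq_mul_div, le_div_iff₀ (by positivity)]
    linarith
  have hen : Tendsto (fun n => ‖estar n‖) atTop (𝓝 0) := by simpa using he.norm
  have huxn : Tendsto (fun n => ‖u n - x n‖) atTop (𝓝 0) := by simpa using hux.norm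
  have huy : Tendsto (fun n => ‖u n - y n‖) atTop (𝓝 0) := by
    apply hsqrt _ (fun n => norm_nonneg _)
    have h1 := ((hπ0.add (hen.const_mul V)).add (huxn.const_mul Y)).const_mul
      (1 / ((1 - δ) * α))
    simp only [mul_zero, add_zero] at h1
    refine squeeze_zero (fun n => by positivity) (fun n => ?_) h1
    have hd : 0 < (1 - δ) * α := mul_pos (by linarith) hα
    rw [div_mul_eq_mul_div, le_div_iff₀ hd, one_mul]
    have e1 : π n = ⟪u n - y n, F n (u n) - F n (y n)⟫ + ⟪u n - y n, estar n⟫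
        + ⟪u n - y n, fstar n⟫ - ⟪u n - x n, ystar n⟫ := by
      have h0 := hS0 (u n - y n)
      have h2 : x n - y n = (u n - y n) - (u n - x n) := by abel
      rw [hπ', h2, inner_sub_left]
      have h3 : ⟪u n - y n, ystar n⟫ = ⟪u n - y n, F n (u n) - F n (y n)⟫
          + ⟪u n - y n, estar n⟫ + ⟪u n - y n, fstar n⟫ := by
        rw [hya, inner_add_right, inner_add_right, inner_sub_right, h0, sub_zero]
      rw [h3]
    have h3 := (hδ n).1
    have h4 := mul_le_mul_of_nonneg_left (hFstrong n (u n) (y n)) (sub_nonneg.2 hδ1.le)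
    have h5 := (abs_le.1 (abs_real_inner_le_norm (u n - y n) (estar n))).1
    have h6 := real_inner_le_norm (u n - x n) (ystar n)
    have h7 := mul_le_mul_of_nonneg_right (hV n) (norm_nonneg (estar n))
    have h8 := mul_le_mul_of_nonneg_left (hY n) (norm_nonneg (u n - x n))
    have h9 := le_max_left (π n) 0
    linarith
  have hd0 : Tendsto (fun n => ‖F n (u n) - F n (y n)‖) atTop (𝓝 0) := by
    have h1 := huy.const_mul ρ
    rw [mul_zero] at h1
    exact squeeze_zero (fun n => norm_nonneg _) (fun n => hFlip n _ _) h1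
  rw [tendsto_zero_iff_norm_tendsto_zero]
  apply hsqrt _ (fun n => norm_nonneg _)
  have h1 := ((hd0.pow 2).add (hd0.const_mul Cf)).const_mul (1 / (1 - δ))
  simp only [mul_zero, add_zero, ne_eq, OfNat.ofNat_ne_zero, not_false_eq_true, zero_pow] at h1
  refine squeeze_zero (fun n => by positivity) (fun n => ?_) h1
  rw [div_mul_eq_mul_div, le_div_iff₀ (by linarith), one_mul]
  have h2 := (hδ n).2
  have e : astar n + S (u n) - estar n = (F n (u n) - F n (y n)) + fstar n := by
    rw [hastar, hustar]; abel
  rw [e, norm_add_sq_real, inner_add_left, real_inner_self_eq_norm_sq] at h2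
  obtain ⟨h3, h4⟩ := abs_le.1 (abs_real_inner_le_norm (F n (u n) - F n (y n)) (fstar n))
  have h5 := mul_le_mul_of_nonneg_left (hCf n) (norm_nonneg (F n (u n) - F n (y n)))
  have h6 : (2 * δ - 1) * ⟪F n (u n) - F n (y n), fstar n⟫ ≤
      ‖F n (u n) - F n (y n)‖ * ‖fstar n‖ := by
    nlinarith
  have h7 := mul_le_mul_of_nonneg_right hδ1.le (sq_nonneg ‖F n (u n) - F n (y n)‖)
  linarith
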